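/- arXiv:1802.06380 — 2 statements merged into one kernel-verified Lean document; each statement's English description precedes it below -/
import Mathlib

section
/- Fix an integer n ≥ 1. Let Q be a real n×n matrix and e₋, e₊ ∈ ℝⁿ vectors with Q + Qᵀ = e₊e₊ᵀ − e₋e₋ᵀ. Let Δx > 0, let W_ρ and W_μ be symmetric real n×n matrices, let Z₋ > 0 and Z₊ > 0, and let v, σ : [0,∞) → ℝⁿ be differentiable. Write v(∓1,t) = e∓ · v(t), σ(∓1,t) = e∓ · σ(t). Let v̂₋, σ̂₋, v̂₊, σ̂₊ : [0,∞) → ℝ be arbitrary, and define F(t) = (Z₋/2)(v(−1,t) − v̂₋(t)) − ½(σ(−1,t) − σ̂₋(t)) and G(t) = (Z₊/2)(v(1,t) − v̂₊(t)) + ½(σ(1,t) − σ̂₊(t)). Assume (Δx/2) W_ρ (dv/dt) = Q σ − e₋ F − e₊ G and (Δx/2) W_μ (dσ/dt) = Q v + e₋ F/Z₋ − e₊ G/Z₊ for all t ≥ 0. Then the elemental energy 𝓔(t) = (Δx/2)( ½ v(t)ᵀ W_ρ v(t) + ½ σ(t)ᵀ W_μ σ(t) ) satisfies d𝓔/dt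 = −(1/Z₋)( F(t)² + p₋(t)² − q̂₋(t)² ) − (1/Z₊)( G(t)² + q₊(t)² − p̂₊(t)² ), where p₋ = ½(Z₋ v(−1,t) + σ(−1,t)), q̂₋ = ½(Z₋ v̂₋ − σ̂₋), q₊ = ½(Z₊ v(1,t) − σ(1,t)), p̂₊ = ½(Z₊ v̂₊ + σ̂₊). -/
open Matrix

theorem HasDerivWithinAt.dotProduct_mulVec_self {n : Type*} [Fintype n]
    {W : Matrix n n ℝ} (hW : W.IsSymm) {u : ℝ → n → ℝ} {u' : n → ℝ} {s : Set ℝ} {t : ℝ}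
    (hu : HasDerivWithinAt u u' s t) :
    HasDerivWithinAt (fun r => u r ⬝ᵥ W *ᵥ u r) (2 * (u t ⬝ᵥ W *ᵥ u')) s t := by
  have hc := hasDerivWithinAt_pi.1 hu
  have hW' : u' ⬝ᵥ W *ᵥ u t = u t ⬝ᵥ W *ᵥ u' := by
    rw [dotProduct_comm, dotProduct_mulVec, ← mulVec_transpose, hW.eq]
  have hmul (i : n) : HasDerivWithinAt (fun r => (W *ᵥ u r) i) ((W *ᵥ u') i) s t :=
    HasDerivWithinAt.fun_sum fun j _ => (hc j).const_mul (W i j)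
  have h : HasDerivWithinAt (fun r => u r ⬝ᵥ W *ᵥ u r)
      (∑ i, (u' i * (W *ᵥ u t) i + u t i * (W *ᵥ u') i)) s t :=
    HasDerivWithinAt.fun_sum fun i _ => (hc i).mul (hmul i)
  convert h using 1
  rw [Finset.sum_add_distrib]
  change _ = u' ⬝ᵥ W *ᵥ u t + u t ⬝ᵥ W *ᵥ u'
  rw [hW', two_mul]

/-- Discrete integration by parts. -/
theorem dotProduct_mulVec_add_of_summation_by_parts {n : Type*} [Fintype n]
    {Q : Matrix n n ℝ} {em ep : n → ℝ}
    (hQ : Q + Qᵀ = vecMulVec ep ep - vecMulVec em em) (x y : n → ℝ) :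
    x ⬝ᵥ Q *ᵥ y + y ⬝ᵥ Q *ᵥ x = (ep ⬝ᵥ x) * (ep ⬝ᵥ y) - (em ⬝ᵥ x) * (em ⬝ᵥ y) := by
  have h : y ⬝ᵥ Q *ᵥ x = x ⬝ᵥ Qᵀ *ᵥ y := by
    rw [mulVec_transpose, dotProduct_mulVec, dotProduct_comm]
  rw [h, ← dotProduct_add, ← add_mulVec, hQ, sub_mulVec, dotProduct_sub,
    vecMulVec_mulVec, vecMulVec_mulVec]
  simp only [op_smul_eq_smul, smul_dotProduct, smul_eq_mul, dotProduct_comm x]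
  ring

/-- the elemental semi-discrete energy-rate identity for the DG scheme
with the summation-by-parts property `Q + Qᵀ = e₊e₊ᵀ − e₋e₋ᵀ`. -/
theorem stmt_16 (n : ℕ) (hn : 1 ≤ n)
    (Q : Matrix (Fin n) (Fin n) ℝ) (em ep : Fin n → ℝ)
    (hSBP : Q + Qᵀ = Matrix.vecMulVec ep ep - Matrix.vecMulVec em em)
    (Δx : ℝ) (hΔx : 0 < Δx)
    (Wρ Wμ : Matrix (Fin n) (Fin n) ℝ) (hWρ : Wρ.IsSymm) (hWμ : Wμ.IsSymm)
    (Zm Zp : ℝ) (hZm : 0 < Zm) (hZp : 0 < Zp)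
    (v σ v' σ' : ℝ → (Fin n → ℝ))
    (hv : ∀ t ∈ Set.Ici (0:ℝ), HasDerivWithinAt v (v' t) (Set.Ici 0) t)
    (hσ : ∀ t ∈ Set.Ici (0:ℝ), HasDerivWithinAt σ (σ' t) (Set.Ici 0) t)
    (vhm σhm vhp σhp : ℝ → ℝ)
    (F G : ℝ → ℝ)
    (hF : ∀ t, F t = Zm/2 * (em ⬝ᵥ v t - vhm t) - 1/2 * (em ⬝ᵥ σ t - σhm t))
    (hG : ∀ t, G t = Zp/2 * (ep ⬝ᵥ v t - vhp t) + 1/2 * (ep ⬝ᵥ σ t - σhp t))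
    (hode1 : ∀ t ∈ Set.Ici (0:ℝ),
      (Δx/2) • Wρ.mulVec (v' t) = Q.mulVec (σ t) - F t • em - G t • ep)
    (hode2 : ∀ t ∈ Set.Ici (0:ℝ),
      (Δx/2) • Wμ.mulVec (σ' t) = Q.mulVec (v t) + (F t / Zm) • em - (G t / Zp) • ep)
    (𝓔 : ℝ → ℝ)
    (h𝓔 : ∀ t, 𝓔 t = Δx/2 * (1/2 * (v t ⬝ᵥ Wρ.mulVec (v t))
      + 1/2 * (σ t ⬝ᵥ Wμ.mulVec (σ t)))) :
    ∀ t ∈ Set.Ici (0:ℝ),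
      HasDerivWithinAt 𝓔
        (-(1/Zm) * ((F t)^2 + (1/2 * (Zm * (em ⬝ᵥ v t) + em ⬝ᵥ σ t))^2
            - (1/2 * (Zm * vhm t - σhm t))^2)
         - (1/Zp) * ((G t)^2 + (1/2 * (Zp * (ep ⬝ᵥ v t) - ep ⬝ᵥ σ t))^2
            - (1/2 * (Zp * vhp t + σhp t))^2))
        (Set.Ici 0) t := by
  intro t ht
  have hE : HasDerivWithinAt 𝓔 (Δx/2 * (1/2 * (2 * (v t ⬝ᵥ Wρ *ᵥ v' t))
      + 1/2 * (2 * (σ t ⬝ᵥ Wμ *ᵥ σ' t)))) (Set.Ici 0) t := by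
    rw [funext h𝓔]
    exact ((((hv t ht).dotProduct_mulVec_self hWρ).const_mul (1/2)).add
      (((hσ t ht).dotProduct_mulVec_self hWμ).const_mul (1/2))).const_mul (Δx/2)
  convert hE using 1
  have h1 := congrArg (v t ⬝ᵥ ·) (hode1 t ht)
  have h2 := congrArg (σ t ⬝ᵥ ·) (hode2 t ht)
  have h3 := dotProduct_mulVec_add_of_summation_by_parts hSBP (v t) (σ t)
  simp only [dotProduct_smul, dotProduct_sub, dotProduct_add, smul_eq_mul,
    dotProduct_comm _ em, dotProduct_comm _ ep] at h1 h2
  have hrate : Δx/2 * (1/2 * (2 * (v t ⬝ᵥ Wρ *ᵥ v' t)) + 1/2 * (2 * (σ t ⬝ᵥ Wμ *ᵥ σ' t)))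
      = (ep ⬝ᵥ v t) * (ep ⬝ᵥ σ t) - (em ⬝ᵥ v t) * (em ⬝ᵥ σ t)
        - F t * (em ⬝ᵥ v t) - G t * (ep ⬝ᵥ v t)
        + F t / Zm * (em ⬝ᵥ σ t) - G t / Zp * (ep ⬝ᵥ σ t) := by
    linear_combination h1 + h2 + h3
  rw [hrate, hF t, hG t]
  field_simp
  ring
end

section
/- Let 0 < x₀ < L. Let ρ⁻, μ⁻ : [0,x₀] → ℝ and ρ⁺, μ⁺ : [x₀,L] → ℝ be continuous and strictly positive, and let v⁻, σ⁻ : [0,x₀] × [0,∞) → ℝ and v⁺, σ⁺ : [x₀,L] × [0,∞) → ℝ be continuously differentiable functions satisfying the elastic wave equation ρ± ∂v±/∂t = ∂σ±/∂x and (1/μ±) ∂σ±/∂t = ∂v±/∂x on their respective domains. Suppose force balance holds at the interface: σ⁻(x₀,t) = σ⁺(x₀,t) =: σ(t) for all t ≥ 0. Define E(t) = ½ ∫₀^{x₀} ( ρ⁻ (v⁻)² + (σ⁻)²/μ⁻ ) dx + ½ ∫_{x₀}^{L} ( ρ⁺ (v⁺)² + (σ⁺)²/μ⁺ ) dx. Then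 for every t ≥ 0, E′(t) = −σ(t) ( v⁺(x₀,t) − v⁻(x₀,t) ) − v⁻(0,t) σ⁻(0,t) + v⁺(L,t) σ⁺(L,t). Moreover, if in addition the friction law σ(t) = α(t) ( v⁺(x₀,t) − v⁻(x₀,t) ) holds with α(t) ≥ 0 for all t, then the interface term satisfies σ(t)(v⁺(x₀,t) − v⁻(x₀,t)) ≥ 0. -/
open Set Filter Topology MeasureTheory in
/-- Differentiation under the integral sign on a half-line, one-sided at the endpoint. -/
theorem hasDerivWithinAt_integral_Ici {a b : ℝ} (hab : a ≤ b) {F F' : ℝ → ℝ → ℝ}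
    (hF : ∀ t ∈ Ici (0:ℝ), ContinuousOn (fun y => F y t) (Icc a b))
    (hF' : ContinuousOn (fun p : ℝ × ℝ => F' p.1 p.2) (Icc a b ×ˢ Ici 0))
    (hd : ∀ y ∈ Icc a b, ∀ t ∈ Ici (0:ℝ), HasDerivWithinAt (F y) (F' y t) (Ici 0) t)
    {t : ℝ} (ht : t ∈ Ici (0:ℝ)) :
    HasDerivWithinAt (fun s => ∫ y in a..b, F y s) (∫ y in a..b, F' y t) (Ici 0) t := by
  have hint : ∀ s ∈ Ici (0:ℝ), IntervalIntegrable (fun y => F y s) volume a b := fun s hs =>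
    (hF s hs).intervalIntegrable_of_Icc hab
  obtain ⟨C, hC⟩ := (isCompact_Icc.prod (isCompact_Icc (a := (0:ℝ)) (b := t + 1))).exists_bound_of_continuousOn
    (hF'.mono (prod_mono_right Icc_subset_Ici_self))
  have hnear : ∀ᶠ s in 𝓝[Ici 0 \ {t}] t, s ∈ Icc 0 (t + 1) := by
    filter_upwards [self_mem_nhdsWithin,
      mem_nhdsWithin_of_mem_nhds (Iio_mem_nhds (lt_add_one t))] with s hs hs'
    exact ⟨hs.1, le_of_lt hs'⟩
  have htI : t ∈ Icc 0 (t + 1) := ⟨ht, by linarith⟩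
  have hsub : uIoc a b ⊆ Icc a b := by
    rw [uIoc_of_le hab]; exact Ioc_subset_Icc_self
  rw [hasDerivWithinAt_iff_tendsto_slope]
  have key : Tendsto (fun s => ∫ y in a..b, slope (F y) t s) (𝓝[Ici 0 \ {t}] t)
      (𝓝 (∫ y in a..b, F' y t)) := by
    refine intervalIntegral.tendsto_integral_filter_of_dominated_convergence (fun _ => C)
      ?_ ?_ intervalIntegrable_const ?_
    · filter_upwards [hnear] with s hs
      have h : IntervalIntegrable (fun y => slope (F y) t s) volume a b := by
        simpa only [slope_def_module, smul_eq_mul] using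
          ((hint s hs.1).sub (hint t ht)).const_mul (s - t)⁻¹
      exact h.def'.aestronglyMeasurable
    · filter_upwards [hnear, self_mem_nhdsWithin] with s hs hs'
      refine Eventually.of_forall fun y hy => ?_
      have hne : 0 < |s - t| := abs_pos.2 (sub_ne_zero.2 hs'.2)
      have h := (convex_Icc (0:ℝ) (t + 1)).norm_image_sub_le_of_norm_hasDerivWithin_le
        (f := F y) (f' := F' y)
        (fun r hr => (hd y (hsub hy) r hr.1).mono Icc_subset_Ici_self)
        (fun r hr => hC (y, r) ⟨hsub hy, hr⟩) htI hs
      rw [slope_def_field, norm_div, Real.norm_eq_abs (s - t), div_le_iff₀ hne]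
      exact h
    · exact Eventually.of_forall fun y hy =>
        hasDerivWithinAt_iff_tendsto_slope.1 (hd y (hsub hy) t ht)
  refine key.congr' ?_
  filter_upwards [hnear] with s hs
  simp only [slope_def_module, smul_eq_mul]
  rw [intervalIntegral.integral_const_mul, intervalIntegral.integral_sub (hint s hs.1) (hint t ht)]

open Set in
/-- Both partial derivatives of a `C¹` function on `[a, b] × [0, ∞)` exist, as one-sided
derivatives at the boundary, and are continuous. -/
theorem ContDiffOn.partial_deriv_strip {a b : ℝ} (hab : a < b) {f : ℝ → ℝ → ℝ}
    (hf : ContDiffOn ℝ 1 (fun p : ℝ × ℝ => f p.1 p.2) (Icc a b ×ˢ Ici 0)) :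
    (∀ y ∈ Icc a b, ∀ t ∈ Ici (0:ℝ),
      HasDerivWithinAt (f y) (derivWithin (fun s => f y s) (Ici 0) t) (Ici 0) t ∧
      HasDerivWithinAt (fun z => f z t) (derivWithin (fun z => f z t) (Icc a b) y) (Icc a b) y) ∧
    ContinuousOn (fun p : ℝ × ℝ => derivWithin (fun s => f p.1 s) (Ici 0) p.2)
      (Icc a b ×ˢ Ici 0) ∧
    ContinuousOn (fun p : ℝ × ℝ => derivWithin (fun z => f z p.2) (Icc a b) p.1)
      (Icc a b ×ˢ Ici 0) := by
  have hU : UniqueDiffOn ℝ (Icc a b ×ˢ Ici (0:ℝ)) :=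
    (uniqueDiffOn_Icc hab).prod (uniqueDiffOn_Ici 0)
  have hc := hf.continuousOn_fderivWithin hU le_rfl
  have h1 : ∀ y ∈ Icc a b, ∀ t ∈ Ici (0:ℝ), HasDerivWithinAt (f y)
      (fderivWithin ℝ (fun p : ℝ × ℝ => f p.1 p.2) (Icc a b ×ˢ Ici 0) (y, t) (0, 1)) (Ici 0) t := by
    intro y hy t ht
    exact ((hf.differentiableOn one_ne_zero) (y, t) ⟨hy, ht⟩).hasFDerivWithinAt.comp_hasDerivWithinAt t
      ((hasDerivWithinAt_const t (Ici 0) y).prodMk (hasDerivWithinAt_id t (Ici 0)))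
      (fun s hs => mk_mem_prod hy hs)
  have h2 : ∀ y ∈ Icc a b, ∀ t ∈ Ici (0:ℝ), HasDerivWithinAt (fun z => f z t)
      (fderivWithin ℝ (fun p : ℝ × ℝ => f p.1 p.2) (Icc a b ×ˢ Ici 0) (y, t) (1, 0))
      (Icc a b) y := by
    intro y hy t ht
    exact ((hf.differentiableOn one_ne_zero) (y, t) ⟨hy, ht⟩).hasFDerivWithinAt.comp_hasDerivWithinAt y
      ((hasDerivWithinAt_id y (Icc a b)).prodMk (hasDerivWithinAt_const y (Icc a b) t))
      (fun s hs => mk_mem_prod hs ht)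
  refine ⟨fun y hy t ht => ⟨(h1 y hy t ht).differentiableWithinAt.hasDerivWithinAt,
    (h2 y hy t ht).differentiableWithinAt.hasDerivWithinAt⟩, ?_, ?_⟩
  · exact (hc.clm_apply continuousOn_const).congr fun p hp =>
      (h1 p.1 hp.1 p.2 hp.2).derivWithin (uniqueDiffOn_Ici 0 p.2 hp.2)
  · exact (hc.clm_apply continuousOn_const).congr fun p hp =>
      (h2 p.1 hp.1 p.2 hp.2).derivWithin (uniqueDiffOn_Icc hab p.1 hp.1)

open Set in
/-- Energy balance for a single elastic block: the energy changes at the rate at which the boundary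
tractions do work. -/
theorem hasDerivWithinAt_elastic_energy {a b : ℝ} (hab : a < b) {ρ μ : ℝ → ℝ}
    (hρ : ContinuousOn ρ (Icc a b)) (hμ : ContinuousOn μ (Icc a b))
    (hμpos : ∀ y ∈ Icc a b, 0 < μ y) {v σ : ℝ → ℝ → ℝ}
    (hv : ContDiffOn ℝ 1 (fun p : ℝ × ℝ => v p.1 p.2) (Icc a b ×ˢ Ici 0))
    (hσ : ContDiffOn ℝ 1 (fun p : ℝ × ℝ => σ p.1 p.2) (Icc a b ×ˢ Ici 0))
    (hpde1 : ∀ y ∈ Icc a b, ∀ t ∈ Ici (0:ℝ),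
      ρ y * derivWithin (fun s => v y s) (Ici 0) t = derivWithin (fun z => σ z t) (Icc a b) y)
    (hpde2 : ∀ y ∈ Icc a b, ∀ t ∈ Ici (0:ℝ),
      (1 / μ y) * derivWithin (fun s => σ y s) (Ici 0) t = derivWithin (fun z => v z t) (Icc a b) y)
    {t : ℝ} (ht : t ∈ Ici (0:ℝ)) :
    HasDerivWithinAt (fun s => ∫ y in a..b, (ρ y * (v y s)^2 + (σ y s)^2 / μ y))
      (2 * (v b t * σ b t - v a t * σ a t)) (Ici 0) t := by
  obtain ⟨hvd, -, hvx⟩ := hv.partial_deriv_strip hab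
  obtain ⟨hσd, -, hσx⟩ := hσ.partial_deriv_strip hab
  have hslice : ∀ s ∈ Ici (0:ℝ), ContinuousOn (fun y : ℝ => (y, s)) (Icc a b) := fun s _ => by
    fun_prop
  have hmaps : ∀ s ∈ Ici (0:ℝ), MapsTo (fun y : ℝ => (y, s)) (Icc a b) (Icc a b ×ˢ Ici 0) :=
    fun s hs y hy => ⟨hy, hs⟩
  have hG : ContinuousOn (fun p : ℝ × ℝ =>
      2 * (derivWithin (fun z => v z p.2) (Icc a b) p.1 * σ p.1 p.2 +
        v p.1 p.2 * derivWithin (fun z => σ z p.2) (Icc a b) p.1)) (Icc a b ×ˢ Ici 0) :=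
    continuousOn_const.mul ((hvx.mul hσ.continuousOn).add (hv.continuousOn.mul hσx))
  have hL := hasDerivWithinAt_integral_Ici hab.le
    (F := fun y s => ρ y * (v y s)^2 + (σ y s)^2 / μ y)
    (F' := fun y s => 2 * (derivWithin (fun z => v z s) (Icc a b) y * σ y s +
        v y s * derivWithin (fun z => σ z s) (Icc a b) y))
    (fun s hs => (hρ.mul ((hv.continuousOn.comp (hslice s hs) (hmaps s hs)).pow 2)).add
      (((hσ.continuousOn.comp (hslice s hs) (hmaps s hs)).pow 2).div hμ
        fun y hy => (hμpos y hy).ne'))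
    hG
    (fun y hy s hs => by
      refine (((((hvd y hy s hs).1.pow 2).const_mul (ρ y))).add
        (((hσd y hy s hs).1.pow 2).div_const (μ y))).congr_deriv ?_
      simp only [← hpde1 y hy s hs, ← hpde2 y hy s hs]
      have := (hμpos y hy).ne'
      field_simp
      ring) ht
  refine hL.congr_deriv ?_
  have hGt := hG.comp (hslice t ht) (hmaps t ht)
  rw [intervalIntegral.integral_eq_sub_of_hasDerivAt_of_le hab.le
    (f := fun y => 2 * (v y t * σ y t))
    (continuousOn_const.mul ((hv.continuousOn.comp (hslice t ht) (hmaps t ht)).mul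
      (hσ.continuousOn.comp (hslice t ht) (hmaps t ht))))
    (fun y hy => ((((hvd y (Ioo_subset_Icc_self hy) t ht).2).mul
      ((hσd y (Ioo_subset_Icc_self hy) t ht).2)).const_mul 2).hasDerivAt
        (Icc_mem_nhds hy.1 hy.2))
    (hGt.intervalIntegrable_of_Icc hab.le)]
  ring

/-- the interface energy identity for two elastic blocks in contact at
`x₀`, with force balance, and nonnegativity of the frictional work rate under the
friction law. -/
theorem stmt_17 (L x₀ : ℝ) (hx₀ : 0 < x₀) (hx₀L : x₀ < L)
    (ρm μm ρp μp : ℝ → ℝ)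
    (hρmc : ContinuousOn ρm (Set.Icc 0 x₀)) (hμmc : ContinuousOn μm (Set.Icc 0 x₀))
    (hρpc : ContinuousOn ρp (Set.Icc x₀ L)) (hμpc : ContinuousOn μp (Set.Icc x₀ L))
    (hρmpos : ∀ y ∈ Set.Icc (0:ℝ) x₀, 0 < ρm y)
    (hμmpos : ∀ y ∈ Set.Icc (0:ℝ) x₀, 0 < μm y)
    (hρppos : ∀ y ∈ Set.Icc x₀ L, 0 < ρp y)
    (hμppos : ∀ y ∈ Set.Icc x₀ L, 0 < μp y)
    (vm σm vp σp : ℝ → ℝ → ℝ)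
    (hvm : ContDiffOn ℝ 1 (fun p : ℝ × ℝ => vm p.1 p.2) (Set.Icc 0 x₀ ×ˢ Set.Ici 0))
    (hσm : ContDiffOn ℝ 1 (fun p : ℝ × ℝ => σm p.1 p.2) (Set.Icc 0 x₀ ×ˢ Set.Ici 0))
    (hvp : ContDiffOn ℝ 1 (fun p : ℝ × ℝ => vp p.1 p.2) (Set.Icc x₀ L ×ˢ Set.Ici 0))
    (hσp : ContDiffOn ℝ 1 (fun p : ℝ × ℝ => σp p.1 p.2) (Set.Icc x₀ L ×ˢ Set.Ici 0))
    (hpde1m : ∀ y ∈ Set.Icc (0:ℝ) x₀, ∀ t ∈ Set.Ici (0:ℝ),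
      ρm y * derivWithin (fun s => vm y s) (Set.Ici 0) t
        = derivWithin (fun z => σm z t) (Set.Icc 0 x₀) y)
    (hpde2m : ∀ y ∈ Set.Icc (0:ℝ) x₀, ∀ t ∈ Set.Ici (0:ℝ),
      (1 / μm y) * derivWithin (fun s => σm y s) (Set.Ici 0) t
        = derivWithin (fun z => vm z t) (Set.Icc 0 x₀) y)
    (hpde1p : ∀ y ∈ Set.Icc x₀ L, ∀ t ∈ Set.Ici (0:ℝ),
      ρp y * derivWithin (fun s => vp y s) (Set.Ici 0) t
        = derivWithin (fun z => σp z t) (Set.Icc x₀ L) y)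
    (hpde2p : ∀ y ∈ Set.Icc x₀ L, ∀ t ∈ Set.Ici (0:ℝ),
      (1 / μp y) * derivWithin (fun s => σp y s) (Set.Ici 0) t
        = derivWithin (fun z => vp z t) (Set.Icc x₀ L) y)
    (hforce : ∀ t ∈ Set.Ici (0:ℝ), σm x₀ t = σp x₀ t)
    (E : ℝ → ℝ)
    (hE : ∀ t, E t
      = 1/2 * (∫ y in (0:ℝ)..x₀, (ρm y * (vm y t)^2 + (σm y t)^2 / μm y))
        + 1/2 * ∫ y in x₀..L, (ρp y * (vp y t)^2 + (σp y t)^2 / μp y)) :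
    (∀ t ∈ Set.Ici (0:ℝ),
      HasDerivWithinAt E
        (-(σm x₀ t * (vp x₀ t - vm x₀ t)) - vm 0 t * σm 0 t + vp L t * σp L t)
        (Set.Ici 0) t) ∧
    (∀ αf : ℝ → ℝ, (∀ t ∈ Set.Ici (0:ℝ), 0 ≤ αf t) →
      (∀ t ∈ Set.Ici (0:ℝ), σm x₀ t = αf t * (vp x₀ t - vm x₀ t)) →
      ∀ t ∈ Set.Ici (0:ℝ), 0 ≤ σm x₀ t * (vp x₀ t - vm x₀ t)) := by
  refine ⟨fun t ht => ?_, fun αf hα hfric t ht => ?_⟩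
  · have hm := hasDerivWithinAt_elastic_energy hx₀ hρmc hμmc hμmpos hvm hσm hpde1m hpde2m ht
    have hp := hasDerivWithinAt_elastic_energy hx₀L hρpc hμpc hμppos hvp hσp hpde1p hpde2p ht
    rw [funext hE]
    refine ((hm.const_mul (1/2)).add (hp.const_mul (1/2))).congr_deriv ?_
    rw [← hforce t ht]
    ring
  · rw [hfric t ht, mul_assoc]
    exact mul_nonneg (hα t ht) (mul_self_nonneg _)
end
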